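/- Let √(D/Q) = [b₀; {b₁,…,b_m, 2b₀}] be a periodic continued fraction expansion of √(D/Q) (m not necessarily minimal). Suppose r, s are positive integers with r² − s²·D₁ = ±1, t = gcd(r, q), and let k be the index with r_k = r/t, s_k = s·q/t. Then q divides t·s_{k+m+1}, and setting r' = t·r_{k+m+1} and s' = t·s_{k+m+1}/q, the pair (r', s') consists of positive integers satisfying r'² − s'²·D₁ = ±1 (i.e., r' + s'√D₁ is a unit of ℤ[√D₁]) and gcd(r', q) = t. -/

import Mathlib

/-- The sequence of complete quotients of `x`: `cq x 0 = x`,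
`cq x (j+1) = 1 / (cq x j - ⌊cq x j⌋)`. -/
noncomputable def cq (x : ℝ) : ℕ → ℝ
  | 0 => x
  | j + 1 => (Int.fract (cq x j))⁻¹

/-- The `j`-th partial quotient of the continued fraction expansion of `x`:
the floor of the `j`-th complete quotient. -/
noncomputable def pq (x : ℝ) (j : ℕ) : ℤ := ⌊cq x j⌋

theorem cq_succ_eq (x : ℝ) (j : ℕ) : cq x (j + 1) = cq (Int.fract x)⁻¹ j := by
  induction j with
  | zero => rfl
  | succ j ih => rw [cq, ih, cq]

theorem cq_add (x : ℝ) (i j : ℕ) : cq (cq x i) j = cq x (i + j) := by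
  induction j with
  | zero => rfl
  | succ j ih => rw [cq, ih, ← Nat.add_assoc, cq]

theorem pq_succ_eq (x : ℝ) (j : ℕ) : pq x (j + 1) = pq (Int.fract x)⁻¹ j := by
  rw [pq, cq_succ_eq, pq]

theorem irrational_fract_inv {x : ℝ} (hx : Irrational x) : Irrational (Int.fract x)⁻¹ := by
  rw [irrational_inv_iff, ← Int.self_sub_floor]
  exact hx.sub_intCast _

theorem irrational_cq {x : ℝ} (hx : Irrational x) (j : ℕ) : Irrational (cq x j) := by
  induction j with
  | zero => exact hx
  | succ j ih => exact irrational_fract_inv ih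

theorem fract_ne_zero {x : ℝ} (hx : Irrational x) : Int.fract x ≠ 0 :=
  fun h => (irrational_fract_inv hx).ne_zero (by rw [h, inv_zero])

theorem one_le_fract_inv {x : ℝ} (hx : Irrational x) : 1 ≤ (Int.fract x)⁻¹ :=
  (one_le_inv₀ ((Int.fract_nonneg x).lt_of_ne' (fract_ne_zero hx))).2
    (Int.fract_lt_one x).le

/-- Reals with the same partial quotients have the same convergents, hence are equal. -/
theorem eq_of_pq_eq {v w : ℝ} (h : ∀ j, pq v j = pq w j) : v = w := by
  have key : ∀ (n : ℕ) (v w : ℝ), (∀ j, pq v j = pq w j) →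
      (GenContFract.of v).convs n = (GenContFract.of w).convs n := by
    intro n
    induction n with
    | zero =>
      intro v w h
      have h0 : ⌊v⌋ = ⌊w⌋ := h 0
      simp [h0]
    | succ n ih =>
      intro v w h
      have h0 : ⌊v⌋ = ⌊w⌋ := h 0
      have h' : ∀ j, pq (Int.fract v)⁻¹ j = pq (Int.fract w)⁻¹ j := fun j => by
        rw [← pq_succ_eq v, ← pq_succ_eq w, h]
      rw [GenContFract.convs_succ, GenContFract.convs_succ, h0, ih _ _ h']
  refine tendsto_nhds_unique (GenContFract.of_convergence v) ?_
  rw [funext fun n => key n v w h]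
  exact GenContFract.of_convergence w

/-- The continuant matrix `∏_{i ≤ n} !![b i, 1; 1, 0]`. -/
def contMatrix (b : ℕ → ℤ) : ℕ → Matrix (Fin 2) (Fin 2) ℤ
  | 0 => !![b 0, 1; 1, 0]
  | n + 1 => !![b 0, 1; 1, 0] * contMatrix (fun i => b (i + 1)) n

theorem contMatrix_add (b : ℕ → ℤ) (m n : ℕ) :
    contMatrix b (m + 1 + n) = contMatrix b m * contMatrix (fun i => b (m + 1 + i)) n := by
  induction m generalizing b with
  | zero =>
    rw [show 0 + 1 + n = n + 1 by ring, contMatrix, contMatrix]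
    simp only [Nat.zero_add, Nat.add_comm 1]
  | succ m ih =>
    rw [show m + 1 + 1 + n = m + 1 + n + 1 by ring, contMatrix, contMatrix, ih, Matrix.mul_assoc]
    simp only [Nat.add_right_comm _ _ 1]

theorem contMatrix_add_head (b b' : ℕ → ℤ) (c : ℤ) (h0 : b' 0 = c + b 0)
    (h : ∀ i, b' (i + 1) = b (i + 1)) (n : ℕ) :
    contMatrix b' n = !![1, c; 0, 1] * contMatrix b n := by
  cases n with
  | zero => simp [contMatrix, h0, add_comm]
  | succ n =>
    simp only [contMatrix, h0, h, ← Matrix.mul_assoc]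
    congr 1
    simp [add_comm]

theorem det_contMatrix (b : ℕ → ℤ) (n : ℕ) :
    (contMatrix b n).det = 1 ∨ (contMatrix b n).det = -1 := by
  induction n generalizing b with
  | zero => simp [contMatrix]
  | succ n ih =>
    rcases ih (fun i => b (i + 1)) with h | h <;>
      rw [contMatrix, Matrix.det_mul, h] <;> simp

theorem contMatrix_succ_zero (b : ℕ → ℤ) (n : ℕ) (j : Fin 2) :
    contMatrix b (n + 1) 0 j
      = b 0 * contMatrix (fun i => b (i + 1)) n 0 j + contMatrix (fun i => b (i + 1)) n 1 j := by
  simp [contMatrix, Matrix.mul_apply, Fin.sum_univ_two]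

theorem contMatrix_succ_one (b : ℕ → ℤ) (n : ℕ) (j : Fin 2) :
    contMatrix b (n + 1) 1 j = contMatrix (fun i => b (i + 1)) n 0 j := by
  simp [contMatrix, Matrix.mul_apply, Fin.sum_univ_two]

theorem contMatrix_pos (b : ℕ → ℤ) (hb : ∀ i, 1 ≤ b i) (n : ℕ) :
    0 < contMatrix b n 0 0 ∧ 0 < contMatrix b n 1 0 := by
  induction n generalizing b with
  | zero => simpa [contMatrix, Int.lt_iff_add_one_le] using hb 0
  | succ n ih =>
    obtain ⟨h1, h2⟩ := ih (fun i => b (i + 1)) fun i => hb _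
    rw [contMatrix_succ_zero, contMatrix_succ_one]
    exact ⟨by nlinarith [hb 0], h1⟩

theorem one_le_pq {x : ℝ} (hx : Irrational x) (h1 : 1 ≤ x) (j : ℕ) : 1 ≤ pq x j := by
  rw [pq, Int.le_floor, Int.cast_one]
  cases j with
  | zero => exact h1
  | succ j => exact one_le_fract_inv (irrational_cq hx j)

theorem convs_eq_contMatrix {x : ℝ} (hx : Irrational x) (n : ℕ) :
    (GenContFract.of x).convs n
      = (contMatrix (pq x) n 0 0 : ℝ) / (contMatrix (pq x) n 1 0 : ℝ) := by
  induction n generalizing x with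
  | zero => simp [contMatrix, pq, cq]
  | succ n ih =>
    have hy := irrational_fract_inv hx
    have hpos := (contMatrix_pos _ (one_le_pq hy (one_le_fract_inv hx)) n).1
    have hne : (contMatrix (pq (Int.fract x)⁻¹) n 0 0 : ℝ) ≠ 0 := by exact_mod_cast hpos.ne'
    rw [GenContFract.convs_succ, ih hy, contMatrix_succ_zero, contMatrix_succ_one]
    simp only [pq_succ_eq]
    rw [show pq x 0 = ⌊x⌋ from rfl]
    push_cast
    rw [one_div_div, add_div, mul_div_cancel_right₀ _ hne]

theorem self_mul_fract_inv {x : ℝ} (hx : Irrational x) :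
    x * (Int.fract x)⁻¹ = ⌊x⌋ * (Int.fract x)⁻¹ + 1 := by
  have h0 := fract_ne_zero hx
  field_simp
  exact (Int.floor_add_fract x).symm

/-- A real is the image of its complete quotient under the Möbius action of `contMatrix`. -/
theorem mul_contMatrix_cq {x : ℝ} (hx : Irrational x) (n : ℕ) :
    x * (contMatrix (pq x) n 1 0 * cq x (n + 1) + contMatrix (pq x) n 1 1)
      = contMatrix (pq x) n 0 0 * cq x (n + 1) + contMatrix (pq x) n 0 1 := by
  induction n generalizing x with
  | zero => simpa [contMatrix, pq, cq] using self_mul_fract_inv hx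
  | succ n ih =>
    have h := ih (irrational_fract_inv hx)
    have hxy := self_mul_fract_inv hx
    rw [contMatrix_succ_zero, contMatrix_succ_zero, contMatrix_succ_one, contMatrix_succ_one,
      cq_succ_eq]
    simp only [pq_succ_eq]
    rw [show pq x 0 = ⌊x⌋ from rfl]
    push_cast
    linear_combination (⌊x⌋ - x) * h + (contMatrix (pq (Int.fract x)⁻¹) n 1 0 *
      cq (Int.fract x)⁻¹ (n + 1) + contMatrix (pq (Int.fract x)⁻¹) n 1 1 : ℝ) * hxy

theorem irrational_sqrt_div {D Q : ℕ} (hns : ¬ ∃ a : ℚ, a ^ 2 = (D : ℚ) / Q) :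
    Irrational √((D : ℝ) / Q) := by
  rintro ⟨a, ha⟩
  refine hns ⟨a, ?_⟩
  have : (a : ℝ) ^ 2 = (D : ℝ) / Q := by rw [ha, Real.sq_sqrt (by positivity)]
  rw [← @Rat.cast_inj ℝ]
  push_cast
  exact this

theorem isCoprime_contMatrix (b : ℕ → ℤ) (n : ℕ) :
    IsCoprime (contMatrix b n 0 0) (contMatrix b n 1 0) := by
  have h := det_contMatrix b n
  rw [Matrix.det_fin_two] at h
  rcases h with h | h
  · exact ⟨contMatrix b n 1 1, -contMatrix b n 0 1, by linear_combination h⟩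
  · exact ⟨-contMatrix b n 1 1, contMatrix b n 0 1, by linear_combination -h⟩

theorem contMatrix_eq_of_convs_eq {x : ℝ} (hx : Irrational x) (h1 : 1 ≤ x) {n p d : ℕ}
    (hd : 0 < d) (hpd : Nat.Coprime p d) (h : (GenContFract.of x).convs n = (p : ℝ) / d) :
    contMatrix (pq x) n 0 0 = p ∧ contMatrix (pq x) n 1 0 = d := by
  rw [convs_eq_contMatrix hx] at h
  refine Rat.div_int_inj (contMatrix_pos _ (one_le_pq hx h1) n).2 (by exact_mod_cast hd)
    (Int.isCoprime_iff_gcd_eq_one.1 (isCoprime_contMatrix _ n)) (by simpa using hpd) ?_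
  rw [← @Rat.cast_inj ℝ]
  push_cast
  exact h

/-- If `x = [b₀; b₁, …, b_m, 2b₀, b₁, …]`, the continuant matrix of a period acts on convergents
as multiplication by an element `P + N x` of norm `±1`, where `N x²` is an integer. -/
theorem exists_period_unit {x : ℝ} (hx : Irrational x) {m : ℕ}
    (hper : ∀ j : ℕ, 1 ≤ j → pq x (j + m + 1) = pq x j) (hper0 : pq x (m + 1) = 2 * pq x 0)
    {A : ℝ} (hA : x ^ 2 = A) (hrat : ∃ a : ℚ, (a : ℝ) = A) :
    ∃ P N E : ℤ, (N : ℝ) * A = E ∧ (P ^ 2 - N * E = 1 ∨ P ^ 2 - N * E = -1) ∧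
      ∀ k, contMatrix (pq x) (k + m + 1) 0 0
          = P * contMatrix (pq x) k 0 0 + E * contMatrix (pq x) k 1 0 ∧
        contMatrix (pq x) (k + m + 1) 1 0
          = N * contMatrix (pq x) k 0 0 + P * contMatrix (pq x) k 1 0 := by
  have hy : cq x (m + 1) = x + pq x 0 := by
    have h : cq x (m + 2) = cq x 1 := eq_of_pq_eq fun j => by
      have := hper (1 + j) (by omega)
      rw [pq, pq, cq_add, cq_add, ← pq, ← pq, ← this]
      congr 1; ring
    have h : Int.fract (cq x (m + 1)) = Int.fract x := inv_injective h
    rw [← Int.floor_add_fract (cq x (m + 1)), h, ← Int.self_sub_floor,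
      show ⌊cq x (m + 1)⌋ = 2 * pq x 0 from hper0, show ⌊x⌋ = pq x 0 from rfl]
    push_cast; ring
  have hmob := mul_contMatrix_cq hx m
  have hdet := det_contMatrix (pq x) m
  have hadd := contMatrix_add (pq x) m
  rw [hy] at hmob
  rw [Matrix.det_fin_two] at hdet
  generalize contMatrix (pq x) m = M at *
  have hlin : x * (M 1 0 * pq x 0 + M 1 1 - M 0 0 : ℤ)
      = (M 0 0 * pq x 0 + M 0 1 : ℤ) - M 1 0 * A := by
    rw [← hA]; push_cast; linear_combination hmob
  have hz : M 1 0 * pq x 0 + M 1 1 - M 0 0 = 0 := by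
    by_contra hne
    obtain ⟨a, rfl⟩ := hrat
    refine (hx.mul_intCast hne) ⟨(M 0 0 * pq x 0 + M 0 1 : ℤ) - M 1 0 * a, ?_⟩
    rw [hlin]; push_cast; ring
  refine ⟨M 0 0, M 1 0, M 0 0 * pq x 0 + M 0 1, ?_, ?_, fun k => ?_⟩
  · rw [hz] at hlin
    push_cast at hlin ⊢
    linarith
  · convert hdet using 2 <;> linear_combination (-M 0 0) * hz
  · rw [show k + m + 1 = m + 1 + k by ring, hadd, contMatrix_add_head (pq x) _ (pq x 0)
      (by rw [Nat.add_zero, hper0]; ring) fun i => by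
        rw [← hper (i + 1) (by omega)]; congr 1; ring]
    simp only [Matrix.mul_apply, Fin.sum_univ_two]
    constructor
    · simp; ring
    · simp; linear_combination (contMatrix (pq x) k 1 0) * hz

/-- Let `√(D/Q) = [b₀; {b₁,…,b_m, 2b₀}]` be a periodic continued fraction expansion of
`√(D/Q)` (`m` not necessarily minimal). Suppose `r, s` are positive integers with
`r² − s²·D₁ = ±1`, `t = gcd(r, q)`, and let `k` be the index with `r_k = r/t`,
`s_k = s·q/t`. Then `q ∣ t·s_{k+m+1}`, and setting `r' = t·r_{k+m+1}` and
`s' = t·s_{k+m+1}/q`, the pair `(r', s')` consists of positive integers satisfying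
`r'² − s'²·D₁ = ±1`, and `gcd(r', q) = t`. -/
theorem stmt_4 (D Q : ℕ) (hD : 0 < D) (hQ : 0 < Q) (hQD : Q < D)
    (hcop : Nat.Coprime D Q)
    (hns : ¬ ∃ a : ℚ, a ^ 2 = (D : ℚ) / Q)
    (q : ℕ) (hq0 : 0 < q) (hqQ : q ∣ Q) (hQq : Q ∣ q ^ 2)
    (hqmin : ∀ q' : ℕ, 0 < q' → q' ∣ Q → Q ∣ q' ^ 2 → q ≤ q')
    (D₁ : ℕ) (hD₁ : Q * D₁ = D * q ^ 2)
    (m : ℕ)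
    (hper : ∀ j : ℕ, 1 ≤ j →
      pq (Real.sqrt ((D : ℝ) / (Q : ℝ))) (j + m + 1) = pq (Real.sqrt ((D : ℝ) / (Q : ℝ))) j)
    (hper0 : pq (Real.sqrt ((D : ℝ) / (Q : ℝ))) (m + 1)
      = 2 * pq (Real.sqrt ((D : ℝ) / (Q : ℝ))) 0)
    (r s : ℕ) (hr : 0 < r) (hs : 0 < s)
    (hunit : (r : ℤ) ^ 2 - (s : ℤ) ^ 2 * (D₁ : ℤ) = 1 ∨
             (r : ℤ) ^ 2 - (s : ℤ) ^ 2 * (D₁ : ℤ) = -1)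
    (t : ℕ) (ht : t = Nat.gcd r q)
    (k : ℕ)
    (hk : (GenContFract.of (Real.sqrt ((D : ℝ) / (Q : ℝ)))).convs k
        = ((r / t : ℕ) : ℝ) / ((s * q / t : ℕ) : ℝ)) :
    ∀ rk sk : ℕ, 0 < rk → 0 < sk → Nat.Coprime rk sk →
      (GenContFract.of (Real.sqrt ((D : ℝ) / (Q : ℝ)))).convs (k + m + 1)
        = (rk : ℝ) / (sk : ℝ) →
      q ∣ t * sk ∧ 0 < t * rk ∧ 0 < t * sk / q ∧
        ((t * rk : ℤ) ^ 2 - ((t * sk / q : ℕ) : ℤ) ^ 2 * (D₁ : ℤ) = 1 ∨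
         (t * rk : ℤ) ^ 2 - ((t * sk / q : ℕ) : ℤ) ^ 2 * (D₁ : ℤ) = -1) ∧
        Nat.gcd (t * rk) q = t := by
  have hx := irrational_sqrt_div hns
  have h1 : 1 ≤ √((D : ℝ) / Q) := by
    rw [Real.one_le_sqrt, one_le_div (by positivity)]
    exact_mod_cast hQD.le
  intro rk sk hrk hsk hcopk hk'
  obtain ⟨P, N, E, hNE, hnorm, hstep⟩ := exists_period_unit hx hper hper0
    (Real.sq_sqrt (by positivity)) ⟨(D : ℚ) / Q, by push_cast; rfl⟩
  obtain ⟨hrt, hst⟩ : t ∣ r ∧ t ∣ q := ht ▸ ⟨Nat.gcd_dvd_left r q, Nat.gcd_dvd_right r q⟩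
  have ht0 : 0 < t := Nat.pos_of_dvd_of_pos hst hq0
  have hrs : Nat.Coprime r s := by
    rw [← Nat.isCoprime_iff_coprime]
    rcases hunit with h | h
    · exact ⟨r, -(s * D₁), by linear_combination h⟩
    · exact ⟨-r, s * D₁, by linear_combination -h⟩
  have hcop0 : Nat.Coprime (r / t) (s * q / t) := by
    rw [Nat.mul_div_assoc _ hst]
    exact (hrs.coprime_div_left hrt).mul_right
      (ht ▸ Nat.coprime_div_gcd_div_gcd (ht ▸ ht0))
  have hsq : t ∣ s * q := hst.mul_left s
  obtain ⟨hp, hd⟩ := contMatrix_eq_of_convs_eq hx h1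
    (Nat.div_pos (Nat.le_of_dvd (by positivity) hsq) ht0) hcop0 hk
  obtain ⟨hp', hd'⟩ := contMatrix_eq_of_convs_eq hx h1 hsk hcopk hk'
  obtain ⟨hs1, hs2⟩ := hstep k
  rw [hp, hd, hp'] at hs1
  rw [hp, hd, hd'] at hs2
  have hr' : (t : ℤ) * (r / t : ℕ) = r := by exact_mod_cast Nat.mul_div_cancel' hrt
  have hsq' : (t : ℤ) * (s * q / t : ℕ) = s * q := by exact_mod_cast Nat.mul_div_cancel' hsq
  have hNE' : N * D = E * Q := by
    field_simp at hNE
    rw [mul_comm E]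
    exact_mod_cast hNE
  obtain ⟨z, rfl⟩ : (Q : ℤ) ∣ N :=
    (Nat.isCoprime_iff_coprime.2 hcop.symm).dvd_of_dvd_mul_right ⟨E, by rw [hNE']; ring⟩
  obtain rfl : E = z * D := by
    have : (Q : ℤ) ≠ 0 := by exact_mod_cast hQ.ne'
    apply mul_right_cancel₀ this
    linear_combination -hNE'
  obtain ⟨w, rfl⟩ := hqQ
  have hw : (w : ℤ) * D₁ = D * q := by
    have : (q : ℤ) ≠ 0 := by exact_mod_cast hq0.ne'
    apply mul_left_cancel₀ this
    have : ((q * w * D₁ : ℕ) : ℤ) = (D * q ^ 2 : ℕ) := by rw [hD₁]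
    push_cast at this
    linear_combination this
  have htr : (t * rk : ℤ) = P * r + z * D * (s * q) := by
    rw [hs1, ← hr', ← hsq']; ring
  have hts : (t * sk : ℤ) = q * (w * z * r + P * s) := by
    rw [Nat.cast_mul q w] at hs2
    linear_combination (t : ℤ) * hs2 + q * w * z * hr' + P * hsq'
  have hdvd : q ∣ t * sk := by
    rw [← Int.natCast_dvd_natCast]
    exact ⟨_, by rw [← hts]; push_cast; rfl⟩
  have hs' : ((t * sk / q : ℕ) : ℤ) = w * z * r + P * s := by
    rw [Int.natCast_div, Nat.cast_mul, hts]
    exact Int.mul_ediv_cancel_left _ (by exact_mod_cast hq0.ne')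
  refine ⟨hdvd, by positivity, Nat.div_pos (Nat.le_of_dvd (by positivity) hdvd) hq0, ?_, ?_⟩
  · have hmul : (t * rk : ℤ) ^ 2 - ((t * sk / q : ℕ) : ℤ) ^ 2 * D₁
        = (P ^ 2 - (q * w : ℕ) * z * (z * D)) * ((r : ℤ) ^ 2 - (s : ℤ) ^ 2 * D₁) := by
      rw [htr, hs']
      push_cast
      linear_combination (-(2 * P * r * z * s + w * z ^ 2 * r ^ 2) - z ^ 2 * D * s ^ 2 * q) * hw
    rw [hmul]
    rcases hnorm with h | h <;> rcases hunit with h' | h' <;> rw [h, h'] <;> simp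
  · have hPq : IsCoprime P q := by
      rcases hnorm with h | h <;> push_cast at h
      · exact ⟨P, -(w * z * (z * D)), by linear_combination h⟩
      · exact ⟨-P, w * z * (z * D), by linear_combination -h⟩
    have hgcd : Int.gcd (t * rk : ℤ) q = Int.gcd r q := by
      rw [htr, ← mul_assoc, Int.gcd_add_mul_right_left]
      exact Int.gcd_mul_right_left_of_gcd_eq_one (Int.isCoprime_iff_gcd_eq_one.1 hPq)
    rw [← Int.gcd_natCast_natCast, Nat.cast_mul, hgcd, Int.gcd_natCast_natCast, ht]
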